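/- arXiv:2509.15073 — 4 statements merged into one kernel-verified Lean document; each statement's English description precedes it below -/
import Mathlib

section
/- Let n ≥ 1 and K ≥ 1 be natural numbers and let μ : {1,…,n} × {1,…,K} → ℝ. Define the batch variation V = ∑_{t=1}^{n−1} max_{k∈{1,…,K}} |μ(t+1,k) − μ(t,k)|, and let k* ∈ {1,…,K} maximize ∑_{t=1}^n μ(t,k) over k. Then for every t ∈ {1,…,n}, max_{k} μ(t,k) − μ(t,k*) ≤ 2V, and consequently ∑_{t=1}^n ( max_k μ(t,k) − μ(t,k*) ) ≤ 2Vn. -/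
open Finset

/-- A real sequence whose consecutive increments on `1, …, n` are bounded by `d` varies by at
most the total of `d` between any two of these indices. -/
theorem abs_sub_le_sum_of_abs_succ_sub_le {n : ℕ} {f d : ℕ → ℝ}
    (h : ∀ i ∈ Finset.Icc 1 (n - 1), |f (i + 1) - f i| ≤ d i)
    {s t : ℕ} (hs : s ∈ Finset.Icc 1 n) (ht : t ∈ Finset.Icc 1 n) :
    |f t - f s| ≤ ∑ i ∈ Finset.Icc 1 (n - 1), d i := by
  wlog hst : s ≤ t generalizing s t
  · rw [abs_sub_comm]
    exact this ht hs (le_of_not_ge hst)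
  rw [Finset.mem_Icc] at hs ht
  have hsub : Finset.Ico s t ⊆ Finset.Icc 1 (n - 1) := fun i hi => by
    simp only [Finset.mem_Ico, Finset.mem_Icc] at hi ⊢
    omega
  calc |f t - f s| = dist (f s) (f t) := by rw [dist_comm, Real.dist_eq]
    _ ≤ ∑ i ∈ Finset.Ico s t, dist (f i) (f (i + 1)) := dist_le_Ico_sum_dist f hst
    _ ≤ ∑ i ∈ Finset.Ico s t, d i := Finset.sum_le_sum fun i hi => by
        rw [dist_comm, Real.dist_eq]
        exact h i (hsub hi)
    _ ≤ ∑ i ∈ Finset.Icc 1 (n - 1), d i :=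
        Finset.sum_le_sum_of_subset_of_nonneg hsub fun i hi _ => (abs_nonneg _).trans (h i hi)

/-- Single-arm approximation bound: within a batch of `n` rounds with `K` arms, if `k*`
maximizes the cumulative mean reward and `V` is the batch variation, then at every round the
gap between the best mean and the mean of `k*` is at most `2V`, and hence the cumulative gap
is at most `2Vn`. -/
theorem single_arm_approx (n K : ℕ) (hn : 1 ≤ n) (hK : 1 ≤ K)
    (μ : ℕ → ℕ → ℝ)
    (hKne : (Finset.Icc 1 K).Nonempty)
    (V : ℝ)
    (hV : V = ∑ t ∈ Finset.Icc 1 (n - 1),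
      (Finset.Icc 1 K).sup' hKne (fun k => |μ (t + 1) k - μ t k|))
    (kstar : ℕ) (hkstar : kstar ∈ Finset.Icc 1 K)
    (hbest : ∀ k ∈ Finset.Icc 1 K,
      ∑ t ∈ Finset.Icc 1 n, μ t k ≤ ∑ t ∈ Finset.Icc 1 n, μ t kstar) :
    (∀ t ∈ Finset.Icc 1 n,
        (Finset.Icc 1 K).sup' hKne (fun k => μ t k) - μ t kstar ≤ 2 * V) ∧
      ∑ t ∈ Finset.Icc 1 n,
        ((Finset.Icc 1 K).sup' hKne (fun k => μ t k) - μ t kstar) ≤ 2 * V * n := by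
  have hvar : ∀ k ∈ Finset.Icc 1 K, ∀ s ∈ Finset.Icc 1 n, ∀ t ∈ Finset.Icc 1 n,
      |μ t k - μ s k| ≤ V := fun k hk s hs t ht => by
    rw [hV]
    exact abs_sub_le_sum_of_abs_succ_sub_le (f := fun i => μ i k)
      (fun i _ => Finset.le_sup' (fun k => |μ (i + 1) k - μ i k|) hk) hs ht
  have hgap : ∀ t ∈ Finset.Icc 1 n,
      (Finset.Icc 1 K).sup' hKne (fun k => μ t k) - μ t kstar ≤ 2 * V := fun t ht => by
    rw [sub_le_iff_le_add]
    refine Finset.sup'_le _ _ fun k hk => ?_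
    obtain ⟨s, hs, hle⟩ := Finset.exists_le_of_sum_le (Finset.nonempty_Icc.2 hn) (hbest k hk)
    have hk_var := (abs_le.1 (hvar k hk s hs t ht)).2
    have hkstar_var := (abs_le.1 (hvar kstar hkstar s hs t ht)).1
    linarith
  refine ⟨hgap, (Finset.sum_le_card_nsmul _ _ _ hgap).trans_eq ?_⟩
  rw [Nat.card_Icc, Nat.add_sub_cancel, nsmul_eq_mul, mul_comm]
end

section
/- Let n ≥ 1 and K ≥ 1 be natural numbers and let μ : {1,…,n} × {1,…,K} → ℝ with batch variation V = ∑_{t=1}^{n−1} max_{k∈{1,…,K}} |μ(t+1,k) − μ(t,k)|. Let Q ⊆ {1,…,n} be a nonempty subset. Then for every t ∈ {1,…,n}, max_k μ(t,k) − max_k ( (1/|Q|) ∑_{t'∈Q} μ(t',k) ) ≤ 2V. -/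
open Finset

/-- Two values of a real sequence on `{1, …, n}` differ by at most its total variation there. -/
lemma abs_sub_le_sum_abs_succ_sub (f : ℕ → ℝ) {n s t : ℕ} (hs : s ∈ Finset.Icc 1 n)
    (ht : t ∈ Finset.Icc 1 n) :
    |f t - f s| ≤ ∑ i ∈ Finset.Icc 1 (n - 1), |f (i + 1) - f i| := by
  wlog hst : s ≤ t generalizing s t
  · rw [abs_sub_comm]
    exact this ht hs (by omega)
  rw [Finset.mem_Icc] at hs ht
  calc |f t - f s| = dist (f s) (f t) := by rw [dist_comm, Real.dist_eq]
    _ ≤ ∑ i ∈ Finset.Ico s t, dist (f i) (f (i + 1)) := dist_le_Ico_sum_dist f hst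
    _ = ∑ i ∈ Finset.Ico s t, |f (i + 1) - f i| :=
      Finset.sum_congr rfl fun i _ => by rw [dist_comm, Real.dist_eq]
    _ ≤ ∑ i ∈ Finset.Icc 1 (n - 1), |f (i + 1) - f i| := by
      refine Finset.sum_le_sum_of_subset_of_nonneg (fun i hi => ?_) fun _ _ _ => abs_nonneg _
      rw [Finset.mem_Ico] at hi
      rw [Finset.mem_Icc]
      omega

/-- Drift bound for non-query rounds: within a batch of `n` rounds with `K` arms and batch
variation `V`, for any nonempty set `Q` of (query) rounds of the batch and any round `t`,
the best mean at `t` exceeds the best average-over-`Q` mean by at most `2V`. -/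
theorem drift_bound (n K : ℕ) (hn : 1 ≤ n) (hK : 1 ≤ K)
    (μ : ℕ → ℕ → ℝ)
    (hKne : (Finset.Icc 1 K).Nonempty)
    (V : ℝ)
    (hV : V = ∑ t ∈ Finset.Icc 1 (n - 1),
      (Finset.Icc 1 K).sup' hKne (fun k => |μ (t + 1) k - μ t k|))
    (Q : Finset ℕ) (hQsub : Q ⊆ Finset.Icc 1 n) (hQne : Q.Nonempty) :
    ∀ t ∈ Finset.Icc 1 n,
      (Finset.Icc 1 K).sup' hKne (fun k => μ t k) -
          (Finset.Icc 1 K).sup' hKne (fun k => (1 / (Q.card : ℝ)) * ∑ t' ∈ Q, μ t' k)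
        ≤ 2 * V := by
  intro t ht
  have drift : ∀ k ∈ Finset.Icc 1 K, ∀ s ∈ Finset.Icc 1 n, |μ t k - μ s k| ≤ V := by
    intro k hk s hs
    rw [hV]
    exact (abs_sub_le_sum_abs_succ_sub (fun i => μ i k) hs ht).trans <|
      Finset.sum_le_sum fun i _ => Finset.le_sup' (fun k => |μ (i + 1) k - μ i k|) hk
  have hV_nonneg : 0 ≤ V := (abs_nonneg _).trans (drift _ hKne.choose_spec t ht)
  rw [sub_le_iff_le_add]
  refine Finset.sup'_le _ _ fun k hk => ?_
  have hcard : (0 : ℝ) < Q.card := by exact_mod_cast hQne.card_pos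
  have havg : μ t k - V ≤ (1 / (Q.card : ℝ)) * ∑ t' ∈ Q, μ t' k := by
    rw [one_div, inv_mul_eq_div, le_div_iff₀ hcard, mul_comm, ← nsmul_eq_mul]
    refine Finset.card_nsmul_le_sum _ _ _ fun s hs => ?_
    linarith [le_of_abs_le (drift k hk s (hQsub hs))]
  have hsup := Finset.le_sup' (fun k => (1 / (Q.card : ℝ)) * ∑ t' ∈ Q, μ t' k) hk
  linarith
end

section
/- Let T ≥ 1 and B ≥ 1 be reals, α ∈ [0,1], and let M ≥ 1 be a natural number with 2^M ≤ T·B^{−α}. For m ∈ {0,…,M−1} set p_m = 2^{(m−M)/2}, and let N_0,…,N_{M−1} ≥ 0 be reals with N_m ≥ B^{1−α}/2^{m+1} for each m. Then ∏_{m=0}^{M−1} (1 − p_m)^{N_m} ≤ exp(−B^{1−α/2}/(2·√T)). -/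
open Finset Real

/-- For `p ≤ 1` and `0 ≤ N`, the real power `(1 - p) ^ N` is at most `exp (-(p * N))`. -/
theorem one_sub_rpow_le_exp_neg_mul {p N : ℝ} (hp : p ≤ 1) (hN : 0 ≤ N) :
    (1 - p) ^ N ≤ Real.exp (-(p * N)) := by
  calc (1 - p) ^ N ≤ Real.exp (-p) ^ N :=
        Real.rpow_le_rpow (sub_nonneg.2 hp) (Real.one_sub_le_exp_neg p) hN
    _ = Real.exp (-(p * N)) := by rw [← Real.exp_mul, neg_mul]

/-- The expected number of initiations at scale `0` already dominates the exponent. -/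
theorem rpow_div_two_mul_sqrt_le {T B α : ℝ} (hT : 0 < T) (hB : 0 < B) {M : ℕ}
    (h2M : (2 : ℝ) ^ M ≤ T * B ^ (-α)) :
    B ^ (1 - α / 2) / (2 * √T) ≤ (2 : ℝ) ^ (-(M : ℝ) / 2) * (B ^ (1 - α) / 2) := by
  have hsplit : B ^ (1 - α / 2) = B ^ (1 - α) * √(B ^ α) := by
    rw [Real.sqrt_eq_rpow, ← Real.rpow_mul hB.le, ← Real.rpow_add hB]
    ring_nf
  have htwo : (2 : ℝ) ^ (-(M : ℝ) / 2) = (√(2 ^ M))⁻¹ := by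
    rw [Real.sqrt_eq_rpow, ← Real.rpow_natCast, ← Real.rpow_mul two_pos.le,
      ← Real.rpow_neg two_pos.le]
    ring_nf
  have hle : √(B ^ α) * √(2 ^ M) ≤ √T := by
    rw [← Real.sqrt_mul (Real.rpow_nonneg hB.le α)]
    apply Real.sqrt_le_sqrt
    rwa [Real.rpow_neg hB.le, ← div_eq_mul_inv, le_div_iff₀' (Real.rpow_pos_of_pos hB α)] at h2M
  have hpos : 0 < √((2 : ℝ) ^ M) := by positivity
  rw [hsplit, htwo, div_le_iff₀ (by positivity)]
  calc B ^ (1 - α) * √(B ^ α)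
      ≤ B ^ (1 - α) * (√T / √(2 ^ M)) := by
        gcongr
        rwa [le_div_iff₀ hpos]
    _ = (√(2 ^ M))⁻¹ * (B ^ (1 - α) / 2) * (2 * √T) := by ring

/-- Probability bound for a long run of non-query rounds: if at each scale `m < M` every one
of `N_m ≥ B^{1−α}/2^{m+1}` independent initiation opportunities fails with probability
`1 − p_m` where `p_m = 2^{(m−M)/2}`, then the probability that all fail is at most
`exp(−B^{1−α/2}/(2√T))`. -/
theorem no_initiation_prob_bound (T B : ℝ) (hT : 1 ≤ T) (hB : 1 ≤ B)
    (α : ℝ) (hα0 : 0 ≤ α) (hα1 : α ≤ 1)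
    (M : ℕ) (hM : 1 ≤ M) (h2M : (2 : ℝ) ^ M ≤ T * B ^ (-α))
    (p : ℕ → ℝ) (hp : ∀ m, p m = (2 : ℝ) ^ (((m : ℝ) - M) / 2))
    (N : ℕ → ℝ) (hN0 : ∀ m ∈ Finset.range M, 0 ≤ N m)
    (hNlb : ∀ m ∈ Finset.range M, B ^ (1 - α) / 2 ^ (m + 1) ≤ N m) :
    ∏ m ∈ Finset.range M, (1 - p m) ^ (N m)
      ≤ Real.exp (-(B ^ (1 - α / 2) / (2 * Real.sqrt T))) := by
  have hp0 : ∀ m, 0 ≤ p m := fun m => by rw [hp]; positivity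
  have hp1 : ∀ m ∈ Finset.range M, p m ≤ 1 := fun m hm => by
    rw [hp]
    apply Real.rpow_le_one_of_one_le_of_nonpos one_le_two
    have : (m : ℝ) ≤ M := by exact_mod_cast (Finset.mem_range.1 hm).le
    linarith
  have hmem : 0 ∈ Finset.range M := Finset.mem_range.2 hM
  calc ∏ m ∈ Finset.range M, (1 - p m) ^ (N m)
      ≤ ∏ m ∈ Finset.range M, Real.exp (-(p m * N m)) :=
        Finset.prod_le_prod (fun m hm => Real.rpow_nonneg (sub_nonneg.2 (hp1 m hm)) _)
          fun m hm => one_sub_rpow_le_exp_neg_mul (hp1 m hm) (hN0 m hm)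
    _ = Real.exp (-∑ m ∈ Finset.range M, p m * N m) := by
        rw [← Real.exp_sum, Finset.sum_neg_distrib]
    _ ≤ Real.exp (-(B ^ (1 - α / 2) / (2 * Real.sqrt T))) := by
        rw [Real.exp_le_exp, neg_le_neg_iff]
        calc B ^ (1 - α / 2) / (2 * √T)
            ≤ (2 : ℝ) ^ (-(M : ℝ) / 2) * (B ^ (1 - α) / 2) :=
              rpow_div_two_mul_sqrt_le (by linarith) (by linarith) h2M
          _ = p 0 * (B ^ (1 - α) / 2 ^ (0 + 1)) := by simp [hp]
          _ ≤ p 0 * N 0 := mul_le_mul_of_nonneg_left (hNlb 0 hmem) (hp0 0)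
          _ ≤ ∑ m ∈ Finset.range M, p m * N m :=
              Finset.single_le_sum (f := fun m => p m * N m)
                (fun m hm => mul_nonneg (hp0 m) (hN0 m hm)) hmem
end

section
/- Let K ≥ 2 be a natural number and T, B, V > 0 be reals with B ≤ T and K·log K ≤ B·V² (natural logarithm). Set Δ_T = T·(K·log K)^{1/3}/(B^{1/3}·V^{2/3}) and Δ_B = (B/T)·Δ_T. Then (T/Δ_T + 1)·2·√(e−1)·√(Δ_B·K·log K) + 2·Δ_B·V + 6·V·Δ_T + 2·T·√((e−1)·K·log K/Δ_B) ≤ 16·T·(K·log K)^{1/3}·V^{1/3}/B^{1/3}. -/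
open Real

theorem sqrt_exp_one_sub_one_le : √(exp 1 - 1) ≤ 4 / 3 := by
  rw [Real.sqrt_le_left (by norm_num)]
  linarith [exp_one_lt_d9]

theorem rpow_one_third_pow_three {x : ℝ} (hx : 0 ≤ x) : (x ^ ((1 : ℝ) / 3)) ^ 3 = x := by
  rw [← rpow_natCast, ← rpow_mul hx]
  norm_num

theorem rpow_two_thirds_eq_sq {x : ℝ} (hx : 0 ≤ x) :
    x ^ ((2 : ℝ) / 3) = (x ^ ((1 : ℝ) / 3)) ^ 2 := by
  rw [← rpow_natCast, ← rpow_mul hx]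
  norm_num

/-- The regret bound in terms of the cube roots `a`, `b`, `v` of `K log K`, `B`, `V`. -/
theorem regret_terms_le_of_cube_roots {a b v T : ℝ} (ha : 0 < a) (hb : 0 < b) (hv : 0 < v)
    (hT : 0 < T) (hbT : b ^ 3 ≤ T) (hab : a ^ 3 ≤ b ^ 3 * (v ^ 3) ^ 2) :
    (T / (T * a / (b * v ^ 2)) + 1) * 2 * √(exp 1 - 1) *
          √(b ^ 3 / T * (T * a / (b * v ^ 2)) * a ^ 3)
        + 2 * (b ^ 3 / T * (T * a / (b * v ^ 2))) * v ^ 3 + 6 * v ^ 3 * (T * a / (b * v ^ 2))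
        + 2 * T * √((exp 1 - 1) * a ^ 3 / (b ^ 3 / T * (T * a / (b * v ^ 2))))
      ≤ 16 * T * a * v / b := by
  have hab' : a ≤ b * v ^ 2 :=
    le_of_pow_le_pow_left₀ three_ne_zero (by positivity) (hab.trans_eq (by ring))
  have hquery : √(b ^ 3 / T * (T * a / (b * v ^ 2)) * a ^ 3) = b * a ^ 2 / v := by
    rw [← Real.sqrt_sq (show 0 ≤ b * a ^ 2 / v by positivity)]
    congr 1
    field_simp
  have herror : √((exp 1 - 1) * a ^ 3 / (b ^ 3 / T * (T * a / (b * v ^ 2))))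
      = √(exp 1 - 1) * (a * v / b) := by
    rw [← Real.sqrt_sq (show 0 ≤ a * v / b by positivity),
      ← Real.sqrt_mul (by linarith [add_one_le_exp (1 : ℝ)])]
    congr 1
    field_simp
  rw [hquery, herror]
  have hs := sqrt_exp_one_sub_one_le
  have hs0 := Real.sqrt_nonneg (exp 1 - 1)
  set s := √(exp 1 - 1)
  have hlead : b ^ 2 * a * v ≤ T * (a * v / b) := by
    calc b ^ 2 * a * v = b ^ 3 * (a * v / b) := by field_simp
      _ ≤ T * (a * v / b) := by gcongr
  have hrest : b * a ^ 2 / v ≤ b ^ 2 * a * v := by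
    calc b * a ^ 2 / v = b * a / v * a := by ring
      _ ≤ b * a / v * (b * v ^ 2) := by gcongr
      _ = b ^ 2 * a * v := by field_simp
  calc _ = 2 * s * (b ^ 2 * a * v + b * a ^ 2 / v) + 2 * (b ^ 2 * a * v)
          + 6 * (T * (a * v / b)) + 2 * s * (T * (a * v / b)) := by field_simp
    _ ≤ 2 * s * (T * (a * v / b) + T * (a * v / b)) + 2 * (T * (a * v / b))
          + 6 * (T * (a * v / b)) + 2 * s * (T * (a * v / b)) := by
        gcongr
        exact hrest.trans hlead
    _ = (6 * s + 8) * (T * (a * v / b)) := by ring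
    _ ≤ 16 * (T * (a * v / b)) := by
        gcongr
        linarith
    _ = 16 * T * a * v / b := by ring

/-- Parameter-optimization step of the Rexp3B regret analysis: with batch length
`Δ_T = T (K log K)^{1/3} / (B^{1/3} V^{2/3})` and per-batch query count `Δ_B = (B/T) Δ_T`,
the total of the four regret terms is at most `16·T·(K log K)^{1/3}·V^{1/3}/B^{1/3}`. -/
theorem rexp3b_parameter_optimization (K : ℕ) (hK : 2 ≤ K) (T B V : ℝ)
    (hT : 0 < T) (hB : 0 < B) (hV : 0 < V) (hBT : B ≤ T)
    (hKB : (K : ℝ) * Real.log K ≤ B * V ^ 2)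
    (ΔT ΔB : ℝ)
    (hΔT : ΔT = T * ((K : ℝ) * Real.log K) ^ ((1 : ℝ) / 3) /
      (B ^ ((1 : ℝ) / 3) * V ^ ((2 : ℝ) / 3)))
    (hΔB : ΔB = (B / T) * ΔT) :
    (T / ΔT + 1) * 2 * Real.sqrt (Real.exp 1 - 1) * Real.sqrt (ΔB * ((K : ℝ) * Real.log K))
        + 2 * ΔB * V + 6 * V * ΔT
        + 2 * T * Real.sqrt ((Real.exp 1 - 1) * ((K : ℝ) * Real.log K) / ΔB)
      ≤ 16 * T * ((K : ℝ) * Real.log K) ^ ((1 : ℝ) / 3) * V ^ ((1 : ℝ) / 3)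
        / B ^ ((1 : ℝ) / 3) := by
  have hL : 0 < (K : ℝ) * Real.log K := by
    have hK' : (1 : ℝ) < K := by exact_mod_cast hK
    exact mul_pos (by linarith) (Real.log_pos hK')
  subst hΔB hΔT
  generalize (K : ℝ) * Real.log K = L at *
  have h := regret_terms_le_of_cube_roots (T := T) (rpow_pos_of_pos hL (1 / 3))
    (rpow_pos_of_pos hB (1 / 3)) (rpow_pos_of_pos hV (1 / 3)) hT
  rw [← rpow_two_thirds_eq_sq hV.le] at h
  simp only [rpow_one_third_pow_three hL.le, rpow_one_third_pow_three hB.le,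
    rpow_one_third_pow_three hV.le] at h
  exact h hBT hKB
end
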